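/- Let T be a d-angulation of a convex n-gon and let e = (i,i+1), f = (j,j+1) be distinct boundary edges. Then the 2×2 determinant d(e,f) = m_{i,j} m_{i+1,j+1} − m_{i,j+1} m_{i+1,j} is either 0 or 1. -/

import Mathlib

noncomputable section

/-- The `k`-th vertex of a regular `n`-gon inscribed in the unit circle. -/
def vtx (n : ℕ) (k : ZMod n) : ℝ × ℝ :=
  (Real.cos (2 * Real.pi * k.val / n), Real.sin (2 * Real.pi * k.val / n))

/-- The convex hull spanned by a set `c` of vertices of the `n`-gon. -/
def cellHull (n : ℕ) (c : Finset (ZMod n)) : Set (ℝ × ℝ) :=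
  convexHull ℝ (vtx n '' (c : Set (ZMod n)))

/-- `T` is a `d`-angulation of the convex `n`-gon: a dissection of the polygon by
pairwise non-crossing diagonals into `d`-gon cells.  Each cell is recorded by its
vertex set; the cells cover the polygon and have pairwise disjoint interiors. -/
def IsDAngulation (n d : ℕ) (T : Finset (Finset (ZMod n))) : Prop :=
  (∀ c ∈ T, c.card = d) ∧
  (⋃ c ∈ T, cellHull n c) = convexHull ℝ (Set.range (vtx n)) ∧
  ∀ c ∈ T, ∀ c' ∈ T, c ≠ c' →
    interior (cellHull n c) ∩ interior (cellHull n c') = ∅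

/-- The number of vertices strictly between `i` and `j`, going counterclockwise. -/
def pathLen (n : ℕ) (i j : ZMod n) : ℕ := (j - i - 1).val

/-- A (counterclockwise) `d`-path from `i` to `j` in the `d`-angulation `T`:
a sequence `p_{i+1}, …, p_{j-1}` of cells of `T`, indexed by the vertices
encountered going counterclockwise from `i` to `j`, such that the cell at
position `k` is incident to the vertex `i+1+k`, and each cell of `T` occurs
at most `d - 2` times in the sequence. -/
def IsDPath (n d : ℕ) (T : Finset (Finset (ZMod n))) (i j : ZMod n)
    (q : Fin (pathLen n i j) → {c // c ∈ T}) : Prop :=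
  (∀ k, (i + 1 + ((k : ℕ) : ZMod n)) ∈ (q k : Finset (ZMod n))) ∧
  ∀ c ∈ T, (Finset.univ.filter (fun k => (q k : Finset (ZMod n)) = c)).card ≤ d - 2

/-- The number `m_{i,j}` of counterclockwise `d`-paths from `i` to `j`. -/
def dPathCount (n d : ℕ) (T : Finset (Finset (ZMod n))) (i j : ZMod n) : ℕ :=
  Nat.card {q : Fin (pathLen n i j) → {c // c ∈ T} // IsDPath n d T i j q}

section Assignments

variable {α : Type*} [Fintype α] [DecidableEq α]

/-- `q` assigns to every element of `S` a cell of `T` containing it, using each cell at most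
`d - 2` times; outside `S` it takes the default value `∅`. -/
def IsAssignment (d : ℕ) (T : Finset (Finset α)) (S : Finset α) (q : α → Finset α) : Prop :=
  (∀ v ∉ S, q v = ∅) ∧ (∀ v ∈ S, q v ∈ T ∧ v ∈ q v) ∧
    ∀ c ∈ T, (S.filter (fun v => q v = c)).card ≤ d - 2

open Classical in
/-- The number of assignments of cells of `T` to the elements of `S`. -/
def assignmentCount (d : ℕ) (T : Finset (Finset α)) (S : Finset α) : ℕ :=
  (Finset.univ.filter (IsAssignment d T S)).card

theorem assignmentCount_empty (d : ℕ) (T : Finset (Finset α)) :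
    assignmentCount d T ∅ = 1 := by
  classical
  rw [assignmentCount, Finset.card_eq_one]
  refine ⟨fun _ => ∅, ?_⟩
  ext q
  simp [IsAssignment, funext_iff]

theorem assignmentCount_eq_zero {d : ℕ} {T : Finset (Finset α)} {S : Finset α}
    (h : ∀ q, ¬ IsAssignment d T S q) : assignmentCount d T S = 0 := by
  classical
  rw [assignmentCount, Finset.card_eq_zero]
  ext q
  simp [h q]

theorem assignmentCount_eq_zero_of_uncovered {d : ℕ} {T : Finset (Finset α)} {S : Finset α}
    {v : α} (hv : v ∈ S) (h : ∀ c ∈ T, v ∉ c) : assignmentCount d T S = 0 :=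
  assignmentCount_eq_zero fun _ hq => h _ (hq.2.1 v hv).1 (hq.2.1 v hv).2

theorem assignmentCount_eq_zero_of_card_lt {d : ℕ} {T : Finset (Finset α)} {S : Finset α}
    (h : T.card * (d - 2) < S.card) : assignmentCount d T S = 0 := by
  refine assignmentCount_eq_zero fun q hq => ?_
  obtain ⟨c, hc, hlt⟩ := Finset.exists_lt_card_fiber_of_mul_lt_card_of_maps_to
    (fun v hv => (hq.2.1 v hv).1) h
  exact absurd (hq.2.2 c hc) (not_le.2 hlt)

theorem assignmentCount_insert {d : ℕ} {T : Finset (Finset α)} {c : Finset α} (hc : c ∉ T)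
    (S : Finset α) :
    assignmentCount d (insert c T) S =
      ∑ W ∈ (S ∩ c).powerset.filter (fun W => W.card ≤ d - 2), assignmentCount d T (S \ W) := by
  classical
  rw [assignmentCount, Finset.card_eq_sum_card_fiberwise
    (f := fun q => S.filter (fun v => q v = c))
    (t := (S ∩ c).powerset.filter (fun W => W.card ≤ d - 2))]
  · refine Finset.sum_congr rfl fun W hW => ?_
    simp only [Finset.mem_filter, Finset.mem_powerset] at hW
    obtain ⟨hW, hWc⟩ := hW
    have hW' : ∀ v ∈ W, v ∈ S ∧ v ∈ c := fun v hv => Finset.mem_inter.1 (hW hv)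
    refine Finset.card_nbij' (fun q v => if v ∈ W then ∅ else q v)
      (fun q v => if v ∈ W then c else q v) ?_ ?_ ?_ ?_
    · intro q hq
      simp only [Finset.coe_filter, Finset.mem_filter, Finset.mem_univ, true_and,
        Set.mem_ofPred_eq] at hq ⊢
      obtain ⟨⟨h1, h2, h3⟩, h4⟩ := hq
      have h5 : ∀ v, v ∈ W ↔ v ∈ S ∧ q v = c := fun v => by rw [← h4]; simp
      refine ⟨?_, ?_, ?_⟩
      · intro v hv
        by_cases hvW : v ∈ W
        · simp [hvW]
        · simp only [hvW, if_false]
          exact h1 v fun hvS => hv (by simp [hvS, hvW])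
      · intro v hv
        rw [Finset.mem_sdiff] at hv
        simp only [hv.2, if_false]
        obtain ⟨h6, h7⟩ := h2 v hv.1
        refine ⟨(Finset.mem_insert.1 h6).resolve_left fun h => hv.2 ((h5 v).2 ⟨hv.1, h⟩), h7⟩
      · intro c' hc'
        refine le_trans (Finset.card_le_card ?_) (h3 c' (Finset.mem_insert_of_mem hc'))
        intro v hv
        simp only [Finset.mem_filter, Finset.mem_sdiff] at hv ⊢
        refine ⟨hv.1.1, ?_⟩
        simpa [hv.1.2] using hv.2
    · intro q hq
      simp only [Finset.coe_filter, Finset.mem_filter, Finset.mem_univ, true_and,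
        Set.mem_ofPred_eq] at hq ⊢
      obtain ⟨h1, h2, h3⟩ := hq
      have h4 : S.filter (fun v => (if v ∈ W then c else q v) = c) = W := by
        ext v
        simp only [Finset.mem_filter]
        by_cases hvW : v ∈ W
        · simp [hvW, (hW' v hvW).1]
        · simp only [hvW, if_false, iff_false, not_and]
          rintro hvS rfl
          exact hc (h2 v (by simp [hvS, hvW])).1
      refine ⟨⟨?_, ?_, ?_⟩, h4⟩
      · intro v hv
        have hvW : v ∉ W := fun h => hv (hW' v h).1
        simp only [hvW, if_false]
        exact h1 v fun h => hv (Finset.mem_sdiff.1 h).1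
      · intro v hv
        by_cases hvW : v ∈ W
        · simp [hvW, (hW' v hvW).2]
        · simp only [hvW, if_false]
          obtain ⟨h6, h7⟩ := h2 v (by simp [hv, hvW])
          exact ⟨Finset.mem_insert_of_mem h6, h7⟩
      · intro c' hc'
        rcases Finset.mem_insert.1 hc' with rfl | hc''
        · rw [h4]; exact hWc
        · refine le_trans (Finset.card_le_card ?_) (h3 c' hc'')
          intro v hv
          simp only [Finset.mem_filter, Finset.mem_sdiff] at hv ⊢
          have hvW : v ∉ W := by
            intro h
            have := hv.2
            simp only [h, if_true] at this
            exact hc (this ▸ hc'')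
          exact ⟨⟨hv.1, hvW⟩, by simpa [hvW] using hv.2⟩
    · intro q hq
      simp only [Finset.coe_filter, Finset.mem_filter, Finset.mem_univ, true_and,
        Set.mem_ofPred_eq] at hq
      funext v
      by_cases hvW : v ∈ W
      · have := hvW
        rw [← hq.2, Finset.mem_filter] at this
        simp [hvW, this.2]
      · simp [hvW]
    · intro q hq
      simp only [Finset.coe_filter, Finset.mem_univ, true_and, Set.mem_ofPred_eq] at hq
      funext v
      by_cases hvW : v ∈ W
      · simp [hvW, hq.1 v (by simp [hvW])]
      · simp [hvW]
  · intro q hq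
    simp only [Finset.coe_filter, Finset.mem_univ, true_and, Set.mem_ofPred_eq,
      Finset.mem_powerset] at hq ⊢
    refine ⟨fun v hv => ?_, hq.2.2 c (Finset.mem_insert_self _ _)⟩
    rw [Finset.mem_filter] at hv
    exact Finset.mem_inter.2 ⟨hv.1, hv.2 ▸ (hq.2.1 v hv.1).2⟩

/-- If elements private to the cell `c` exhaust `c ∩ S` or the capacity of `c`, then `c` is used
exactly for them. -/
theorem assignmentCount_insert_forced {d : ℕ} {T : Finset (Finset α)} {c : Finset α}
    (hc : c ∉ T) {S U : Finset α} (hU : U ⊆ S ∩ c) (hpriv : ∀ u ∈ U, ∀ c' ∈ T, u ∉ c')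
    (hcard : U.card ≤ d - 2) (hfull : S ∩ c ⊆ U ∨ U.card = d - 2) :
    assignmentCount d (insert c T) S = assignmentCount d T (S \ U) := by
  rw [assignmentCount_insert hc]
  refine Finset.sum_eq_single_of_mem U (Finset.mem_filter.2 ⟨Finset.mem_powerset.2 hU, hcard⟩) fun W hW hne => ?_
  simp only [Finset.mem_filter, Finset.mem_powerset] at hW
  have h : ¬ U ⊆ W := by
    intro h
    rcases hfull with h' | h'
    · exact hne ((hW.1.trans h').antisymm h)
    · exact hne (Finset.eq_of_subset_of_card_le h (h' ▸ hW.2)).symm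
  obtain ⟨u, hu, huW⟩ := Finset.not_subset.1 h
  exact assignmentCount_eq_zero_of_uncovered (v := u)
    (Finset.mem_sdiff.2 ⟨(Finset.mem_inter.1 (hU hu)).1, huW⟩) (hpriv u hu)

/-- If `S ∩ c` consists of elements private to `c` and one further element `a`, and `c` has
capacity for all of them, then `c` may or may not be used for `a`. -/
theorem assignmentCount_insert_choice {d : ℕ} {T : Finset (Finset α)} {c : Finset α}
    (hc : c ∉ T) {S U : Finset α} {a : α} (hU : S ∩ c = insert a U) (ha : a ∉ U)
    (hpriv : ∀ u ∈ U, ∀ c' ∈ T, u ∉ c') (hcard : U.card + 1 ≤ d - 2) :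
    assignmentCount d (insert c T) S =
      assignmentCount d T (S \ insert a U) + assignmentCount d T (S \ U) := by
  have hne : insert a U ≠ U := fun h => ha (h ▸ Finset.mem_insert_self a U)
  rw [assignmentCount_insert hc, 
    ← Finset.sum_pair (f := fun W => assignmentCount d T (S \ W)) hne]
  symm
  refine Finset.sum_subset ?_ fun W hW hW' => ?_
  · intro W hW
    rw [Finset.mem_insert, Finset.mem_singleton] at hW
    rw [hU, Finset.mem_filter, Finset.mem_powerset]
    rcases hW with rfl | rfl
    · exact ⟨subset_rfl, by rwa [Finset.card_insert_of_notMem ha]⟩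
    · exact ⟨Finset.subset_insert _ _, by omega⟩
  · simp only [Finset.mem_filter, Finset.mem_powerset, hU] at hW
    simp only [Finset.mem_insert, Finset.mem_singleton, not_or] at hW'
    have h : ¬ U ⊆ W := by
      intro h
      by_cases haW : a ∈ W
      · exact hW'.1 (hW.1.antisymm (Finset.insert_subset haW h))
      · refine hW'.2 (Finset.Subset.antisymm (fun v hv => ?_) h)
        exact (Finset.mem_insert.1 (hW.1 hv)).resolve_left fun h => haW (h ▸ hv)
    obtain ⟨u, hu, huW⟩ := Finset.not_subset.1 h
    have huS : u ∈ S ∩ c := hU ▸ Finset.mem_insert_of_mem hu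
    exact assignmentCount_eq_zero_of_uncovered (v := u)
      (Finset.mem_sdiff.2 ⟨(Finset.mem_inter.1 huS).1, huW⟩) (hpriv u hu)

/-- If `S \ c` already exhausts the total capacity of `T`, then `c` is used on all of `S ∩ c`. -/
theorem assignmentCount_insert_of_le_card {d : ℕ} {T : Finset (Finset α)} {c : Finset α}
    (hc : c ∉ T) {S : Finset α} (hcard : (S ∩ c).card ≤ d - 2)
    (hfull : T.card * (d - 2) ≤ (S \ c).card) :
    assignmentCount d (insert c T) S = assignmentCount d T (S \ c) := by
  rw [assignmentCount_insert hc, ← Finset.sdiff_inter_self_left S c]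
  refine Finset.sum_eq_single_of_mem (S ∩ c) 
    (Finset.mem_filter.2 ⟨Finset.mem_powerset.2 subset_rfl, hcard⟩) fun W hW hne => ?_
  simp only [Finset.mem_filter, Finset.mem_powerset] at hW
  refine assignmentCount_eq_zero_of_card_lt (hfull.trans_lt (Finset.card_lt_card ?_))
  rw [Finset.ssubset_iff_of_subset]
  · obtain ⟨v, hv, hvW⟩ := Finset.not_subset.1 fun h => hne (hW.1.antisymm h)
    rw [Finset.mem_inter] at hv
    exact ⟨v, Finset.mem_sdiff.2 ⟨hv.1, hvW⟩, by simp [hv.2]⟩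
  · intro v hv
    rw [Finset.mem_sdiff] at hv ⊢
    exact ⟨hv.1, fun h => hv.2 (Finset.mem_inter.1 (hW.1 h)).2⟩

end Assignments

section Ears

variable {α : Type*}

/-- No two chords of distinct members of `T` cross, where the points are ordered by `r`. -/
def Noncrossing (r : α → ℕ) (T : Finset (Finset α)) : Prop :=
  ∀ c ∈ T, ∀ c' ∈ T, c ≠ c' → ∀ x ∈ c, ∀ y ∈ c', ∀ x' ∈ c, ∀ y' ∈ c',
    r x < r y → r y < r x' → r x' < r y' → False

theorem Noncrossing.mono {r : α → ℕ} {T T' : Finset (Finset α)} (h : Noncrossing r T)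
    (hT : T' ⊆ T) : Noncrossing r T' :=
  fun c hc c' hc' => h c (hT hc) c' (hT hc')

/-- The difference between the largest and the smallest value of `r` on `c`. -/
def span (r : α → ℕ) (c : Finset α) : ℕ := (c ×ˢ c).sup fun p => r p.2 - r p.1

variable [DecidableEq α]

/-- A nonempty noncrossing family contains a cell such that no other cell has elements strictly
between the extreme elements of that cell. -/
theorem Noncrossing.exists_ear {r : α → ℕ} (hr : Function.Injective r) {d : ℕ} (hd : 3 ≤ d)
    {T : Finset (Finset α)} (hT : Noncrossing r T) (hcard : ∀ c ∈ T, c.card = d)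
    (hne : T.Nonempty) :
    ∃ c ∈ T, ∃ a ∈ c, ∃ b ∈ c, (∀ v ∈ c, r a ≤ r v ∧ r v ≤ r b) ∧ r a < r b ∧
      ∀ c' ∈ T, c' ≠ c → ∀ w ∈ c', ¬ (r a < r w ∧ r w < r b) := by
  obtain ⟨c, hc, hmin⟩ := Finset.exists_min_image T (span r) hne
  have hcne : c.Nonempty := Finset.card_pos.1 (by have := hcard c hc; omega)
  obtain ⟨a, ha, hamin⟩ := Finset.exists_min_image c r hcne
  obtain ⟨b, hb, hbmax⟩ := Finset.exists_max_image c r hcne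
  obtain ⟨m, hm, hma⟩ : ∃ m ∈ c, m ∉ ({a, b} : Finset α) := by
    by_contra! h
    have h1 := Finset.card_le_card (show c ⊆ {a, b} from h)
    have h2 := Finset.card_le_two (a := a) (b := b)
    have := hcard c hc
    omega
  simp only [Finset.mem_insert, Finset.mem_singleton, not_or] at hma
  have hram : r a < r m := lt_of_le_of_ne (hamin m hm) fun h => hma.1 (hr h).symm
  have hrmb : r m < r b := lt_of_le_of_ne (hbmax m hm) fun h => hma.2 (hr h)
  refine ⟨c, hc, a, ha, b, hb, fun v hv => ⟨hamin v hv, hbmax v hv⟩, hram.trans hrmb, ?_⟩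
  rintro c' hc' hcc' w hw ⟨haw, hwb⟩
  by_cases hin : ∃ w ∈ c', w ∉ c ∧ r a < r w ∧ r w < r b
  · obtain ⟨w, hw, hwc, haw, hwb⟩ := hin
    obtain ⟨x, hx, hxmax⟩ := Finset.exists_max_image (c.filter (fun v => r v < r w)) r
      ⟨a, by simp [ha, haw]⟩
    obtain ⟨y, hy, hymin⟩ := Finset.exists_min_image (c.filter (fun v => r w < r v)) r
      ⟨b, by simp [hb, hwb]⟩
    simp only [Finset.mem_filter, and_imp] at hx hy hxmax hymin
    have hsub : ∀ z ∈ c', r x ≤ r z ∧ r z ≤ r y := by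
      intro z hz
      constructor
      · by_contra! h
        exact hT c' hc' c hc hcc' z hz x hx.1 w hw y hy.1 h hx.2 hy.2
      · by_contra! h
        exact hT c hc c' hc' hcc'.symm x hx.1 w hw y hy.1 z hz hx.2 hy.2 h
    have h1 : span r c' ≤ r y - r x := by
      refine Finset.sup_le fun p hp => ?_
      rw [Finset.mem_product] at hp
      have := hsub _ hp.1
      have := hsub _ hp.2
      omega
    have h2 : r b - r a ≤ span r c :=
      Finset.le_sup (f := fun p : α × α => r p.2 - r p.1) (Finset.mk_mem_product ha hb)
    have h3 := hmin c' hc'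
    have h4 : r a ≤ r x := hamin x hx.1
    have h5 : r y ≤ r b := hbmax y hy.1
    have h6 : r m ≠ r w := fun h => hwc (hr h ▸ hm)
    rcases lt_or_gt_of_ne h6 with h6 | h6
    · have := hxmax m hm h6
      omega
    · have := hymin m hm h6
      omega
  · push Not at hin
    have hwc : w ∈ c := by
      by_contra h
      exact absurd (hin w hw h haw) (by omega)
    obtain ⟨z, hz, hzc⟩ := Finset.not_subset.1 fun h : c' ⊆ c =>
      hcc' (Finset.eq_of_subset_of_card_le h (by rw [hcard c hc, hcard c' hc']))
    have hza : r z ≠ r a := fun h => hzc (hr h ▸ ha)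
    rcases lt_or_gt_of_ne hza with h | h
    · exact hT c' hc' c hc hcc' z hz a ha w hw b hb h haw hwb
    · have h1 := hin z hz hzc h
      have hzb : r z ≠ r b := fun h => hzc (hr h ▸ hb)
      exact hT c hc c' hc' hcc'.symm a ha w hw b hb z hz haw hwb (by omega)

theorem card_eq_card_filter_between_add_two {r : α → ℕ} (hr : Function.Injective r)
    {c : Finset α} {a b : α} (ha : a ∈ c) (hb : b ∈ c)
    (hab : r a < r b) (h : ∀ v ∈ c, r a ≤ r v ∧ r v ≤ r b) :
    (c.filter fun v => r a < r v ∧ r v < r b).card + 2 = c.card := by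
  have hne : a ≠ b := fun h => by simp [h] at hab
  rw [← Finset.card_pair hne, ← Finset.card_union_of_disjoint]
  · congr 1
    ext v
    simp only [Finset.mem_union, Finset.mem_filter, Finset.mem_insert, Finset.mem_singleton]
    constructor
    · rintro (h | rfl | rfl)
      exacts [h.1, ha, hb]
    · intro hv
      by_cases h1 : v = a
      · simp [h1]
      · by_cases h2 : v = b
        · simp [h2]
        · have h3 : r v ≠ r a := fun h => h1 (hr h)
          have h4 : r v ≠ r b := fun h => h2 (hr h)
          have := h v hv
          exact Or.inl ⟨hv, by omega, by omega⟩
  · rw [Finset.disjoint_left]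
    intro v hv hv'
    simp only [Finset.mem_filter, Finset.mem_insert, Finset.mem_singleton] at hv hv'
    rcases hv' with rfl | rfl <;> omega

/-- A noncrossing family of `d`-subsets of `V` has at most `(|V| - 2) / (d - 2)` members. -/
theorem Noncrossing.card_mul_add_two_le {r : α → ℕ} (hr : Function.Injective r) {d : ℕ}
    (hd : 3 ≤ d) {T : Finset (Finset α)} {V : Finset α} (hT : Noncrossing r T)
    (hcard : ∀ c ∈ T, c.card = d) (hsub : ∀ c ∈ T, c ⊆ V) (hV : 2 ≤ V.card) :
    T.card * (d - 2) + 2 ≤ V.card := by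
  induction hk : T.card generalizing T V with
  | zero => simpa using hV
  | succ k ih =>
    obtain ⟨c, hc, a, ha, b, hb, hext, hab, hear⟩ :=
      hT.exists_ear hr hd hcard (Finset.card_pos.1 (by omega))
    have hsplit := Finset.card_filter_add_card_filter_not (s := V)
      (fun v => r a < r v ∧ r v < r b)
    have hin : c.card ≤ (V.filter fun v => r a < r v ∧ r v < r b).card + 2 := by
      rw [← card_eq_card_filter_between_add_two hr ha hb hab hext]
      exact Nat.add_le_add_right (Finset.card_le_card (Finset.filter_subset_filter _ (hsub c hc))) 2
    have hne : a ≠ b := fun h => by simp [h] at hab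
    have := ih (T := T.erase c) (V := V.filter fun v => ¬ (r a < r v ∧ r v < r b))
      (hT.mono (Finset.erase_subset _ _)) (fun c' hc' => hcard c' (Finset.mem_of_mem_erase hc'))
      (fun c' hc' v hv => Finset.mem_filter.2 ⟨hsub c' (Finset.mem_of_mem_erase hc') hv,
        hear c' (Finset.mem_of_mem_erase hc') (Finset.ne_of_mem_erase hc') v hv⟩)
      (by
        rw [← Finset.card_pair hne]
        refine Finset.card_le_card fun v hv => ?_
        rw [Finset.mem_insert, Finset.mem_singleton] at hv
        rcases hv with rfl | rfl
        · simp [hsub c hc ha]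
        · simp [hsub c hc hb])
      (by rw [Finset.card_erase_of_mem hc]; omega)
    rw [hcard c hc] at hin
    rw [Nat.succ_mul]
    omega

/-- A combinatorial `d`-angulation of the polygon with vertex set `V`, whose vertices are ordered
by `r`. -/
structure IsCombAngulation (r : α → ℕ) (d : ℕ) (V : Finset α) (T : Finset (Finset α)) :
    Prop where
  noncrossing : Noncrossing r T
  card_eq : ∀ c ∈ T, c.card = d
  subset : ∀ c ∈ T, c ⊆ V
  count : T.card * (d - 2) + 2 = V.card

/-- `U` is the set of inner vertices of a `d`-gon `c` glued to the edge `(a, b)` of a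
`d`-angulation `T` of the polygon `V`. -/
structure IsEar (r : α → ℕ) (d : ℕ) (V : Finset α) (T : Finset (Finset α)) (c U : Finset α)
    (a b : α) : Prop where
  ang : IsCombAngulation r d V T
  notMem : c ∉ T
  mem_iff : ∀ v, v ∈ c ↔ v ∈ U ∨ v = a ∨ v = b
  card_inner : U.card = d - 2
  inner : ∀ u ∈ U, r a < r u ∧ r u < r b
  left_mem : a ∈ V
  right_mem : b ∈ V
  lt : r a < r b
  outer : ∀ v ∈ V, ¬ (r a < r v ∧ r v < r b)

theorem IsCombAngulation.exists_isEar {r : α → ℕ} (hr : Function.Injective r) {d : ℕ}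
    (hd : 3 ≤ d) {V : Finset α} {T : Finset (Finset α)} (h : IsCombAngulation r d V T)
    (hne : T.Nonempty) :
    ∃ c ∈ T, ∃ V' U a b, IsEar r d V' (T.erase c) c U a b ∧ V = V' ∪ U := by
  obtain ⟨c, hc, a, ha, b, hb, hext, hab, hear⟩ := h.noncrossing.exists_ear hr hd h.card_eq hne
  have haV := h.subset c hc ha
  have hbV := h.subset c hc hb
  have hsplit := Finset.card_filter_add_card_filter_not (s := V)
    (fun v => r a < r v ∧ r v < r b)
  have hin := card_eq_card_filter_between_add_two hr ha hb hab hext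
  have hsub : (c.filter fun v => r a < r v ∧ r v < r b) ⊆
      V.filter fun v => r a < r v ∧ r v < r b := Finset.filter_subset_filter _ (h.subset c hc)
  have hle := Finset.card_le_card hsub
  have hne : a ≠ b := fun h => by simp [h] at hab
  have hnc : Noncrossing r (T.erase c) := h.noncrossing.mono (Finset.erase_subset _ _)
  have hcd : ∀ c' ∈ T.erase c, c'.card = d :=
    fun c' hc' => h.card_eq c' (Finset.mem_of_mem_erase hc')
  have hsub' : ∀ c' ∈ T.erase c, c' ⊆ V.filter fun v => ¬ (r a < r v ∧ r v < r b) :=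
    fun c' hc' v hv => Finset.mem_filter.2 ⟨h.subset c' (Finset.mem_of_mem_erase hc') hv,
      hear c' (Finset.mem_of_mem_erase hc') (Finset.ne_of_mem_erase hc') v hv⟩
  have hV' : 2 ≤ (V.filter fun v => ¬ (r a < r v ∧ r v < r b)).card := by
    rw [← Finset.card_pair hne]
    refine Finset.card_le_card fun v hv => ?_
    rw [Finset.mem_insert, Finset.mem_singleton] at hv
    rcases hv with rfl | rfl
    · simp [haV]
    · simp [hbV]
  have hbound := hnc.card_mul_add_two_le hr hd hcd hsub' hV'
  have hcount := h.count
  have hcc := h.card_eq c hc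
  obtain ⟨k, hk⟩ : ∃ k, T.card = k + 1 :=
    ⟨T.card - 1, by have := Finset.card_pos.2 ⟨c, hc⟩; omega⟩
  have hk' : (T.erase c).card = k := by rw [Finset.card_erase_of_mem hc]; omega
  rw [hk'] at hbound
  rw [hk, Nat.succ_mul] at hcount
  have heq := Finset.eq_of_subset_of_card_le hsub (by omega)
  refine ⟨c, hc, V.filter fun v => ¬ (r a < r v ∧ r v < r b),
    V.filter fun v => r a < r v ∧ r v < r b, a, b, ⟨⟨hnc, hcd, hsub', ?_⟩, by simp, ?_, ?_, ?_,
      by simp [haV], by simp [hbV], hab, ?_⟩, ?_⟩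
  · rw [hk']
    omega
  · intro v
    rw [← heq, Finset.mem_filter]
    constructor
    · intro hv
      by_cases h1 : v = a
      · simp [h1]
      · by_cases h2 : v = b
        · simp [h2]
        · have h3 : r v ≠ r a := fun h => h1 (hr h)
          have h4 : r v ≠ r b := fun h => h2 (hr h)
          have := hext v hv
          exact Or.inl ⟨hv, by omega, by omega⟩
    · rintro (h | rfl | rfl)
      exacts [h.1, ha, hb]
  · omega
  · intro u hu
    exact (Finset.mem_filter.1 hu).2
  · intro v hv
    exact (Finset.mem_filter.1 hv).2
  · rw [Finset.union_comm, Finset.filter_union_filter_not_eq]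

end Ears

section Arcs

variable {α : Type*} [Fintype α] [DecidableEq α] {r : α → ℕ} {d : ℕ} {V : Finset α}
  {T : Finset (Finset α)}

/-- The elements of `V` strictly between `x` and `y` in the cyclic order induced by `r`; this is
everything except `x` if `x = y`. -/
def arc (r : α → ℕ) (V : Finset α) (x y : α) : Finset α :=
  V.filter fun v => (r x < r v ∧ r v < r y) ∨ (r y ≤ r x ∧ (r x < r v ∨ r v < r y))

/-- The number of `d`-paths from `x` to `y` in the polygon with vertex set `V`. -/
def pathCount (r : α → ℕ) (d : ℕ) (V : Finset α) (T : Finset (Finset α)) (x y : α) : ℕ :=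
  assignmentCount d T (arc r V x y)

/-- `(x, y)` is a boundary edge of the polygon with vertex set `V`. -/
def IsBoundaryEdge (r : α → ℕ) (V : Finset α) (x y : α) : Prop :=
  x ∈ V ∧ y ∈ V ∧ x ≠ y ∧ arc r V x y = ∅

theorem mem_arc {v x y : α} : v ∈ arc r V x y ↔
    v ∈ V ∧ ((r x < r v ∧ r v < r y) ∨ (r y ≤ r x ∧ (r x < r v ∨ r v < r y))) :=
  Finset.mem_filter

theorem IsBoundaryEdge.notMem_arc {x y v : α} (h : IsBoundaryEdge r V x y) (hv : v ∈ V) :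
    ¬ ((r x < r v ∧ r v < r y) ∨ (r y ≤ r x ∧ (r x < r v ∨ r v < r y))) := by
  intro h'
  have : v ∈ arc r V x y := mem_arc.2 ⟨hv, h'⟩
  rw [h.2.2.2] at this
  exact Finset.notMem_empty v this

theorem IsBoundaryEdge.right_ne (hr : Function.Injective r) {x x' y y' : α}
    (h : IsBoundaryEdge r V x x') (h' : IsBoundaryEdge r V y y') (hne : x ≠ y) : x' ≠ y' := by
  rintro rfl
  have h1 := h.notMem_arc h'.1
  have h2 := h'.notMem_arc h.1
  have h3 := hr.ne hne
  have h4 := hr.ne h.2.2.1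
  have h5 := hr.ne h'.2.2.1
  omega

theorem pathCount_self (hr : Function.Injective r) (h : IsCombAngulation r d V T) {x : α}
    (hx : x ∈ V) : pathCount r d V T x x = 0 := by
  have harc : arc r V x x = V.erase x := by
    ext v
    rw [mem_arc, Finset.mem_erase, ← hr.ne_iff]
    refine ⟨fun ⟨hv, h⟩ => ⟨by omega, hv⟩, fun ⟨h, hv⟩ => ⟨hv, by omega⟩⟩
  refine assignmentCount_eq_zero_of_card_lt ?_
  rw [harc, Finset.card_erase_of_mem hx, ← h.count]
  omega

theorem pathCount_eq_one_of_isBoundaryEdge {x y : α} (h : IsBoundaryEdge r V x y) :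
    pathCount r d V T x y = 1 := by
  rw [pathCount, h.2.2.2, assignmentCount_empty]

namespace IsEar

variable {c U : Finset α} {a b : α}

theorem isBoundaryEdge (h : IsEar r d V T c U a b) : IsBoundaryEdge r V a b := by
  refine ⟨h.left_mem, h.right_mem, fun hab => ?_, ?_⟩
  · have := h.lt
    simp [hab] at this
  · ext v
    have := h.lt
    simp only [mem_arc, Finset.notMem_empty, iff_false, not_and]
    intro hv
    have := h.outer v hv
    omega

theorem inner_notMem (h : IsEar r d V T c U a b) : ∀ u ∈ U, u ∉ V :=
  fun u hu hV => h.outer u hV (h.inner u hu)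

theorem inner_private (h : IsEar r d V T c U a b) : ∀ u ∈ U, ∀ c' ∈ T, u ∉ c' :=
  fun u hu c' hc' huc => h.inner_notMem u hu (h.ang.subset c' hc' huc)

theorem mem_iff_rank (h : IsEar r d V T c U a b) (hr : Function.Injective r) (v : α) :
    v ∈ c ↔ v ∈ U ∨ r v = r a ∨ r v = r b := by
  rw [h.mem_iff, hr.eq_iff, hr.eq_iff]

theorem card_cell (h : IsEar r d V T c U a b) (hd : 3 ≤ d) : c.card = d := by
  have h1 : c = insert a (insert b U) := by
    ext v
    rw [h.mem_iff]
    simp only [Finset.mem_insert]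
    tauto
  have hb : b ∉ U := fun hb => (h.inner b hb).2.ne rfl
  have ha : a ∉ insert b U := by
    rw [Finset.mem_insert, not_or]
    exact ⟨h.isBoundaryEdge.2.2.1, fun ha => (h.inner a ha).1.ne rfl⟩
  rw [h1, Finset.card_insert_of_notMem ha, Finset.card_insert_of_notMem hb, h.card_inner]
  omega

/-- Gluing an ear does not change the path counts between old vertices. -/
theorem pathCount_outer (h : IsEar r d V T c U a b) (hr : Function.Injective r) {x y : α}
    (hx : x ∈ V) (hy : y ∈ V) :
    pathCount r d (V ∪ U) (insert c T) x y = pathCount r d V T x y := by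
  have ox := h.outer x hx
  have oy := h.outer y hy
  have hab := h.lt
  by_cases hin : (r x ≤ r a ∧ r b ≤ r y) ∨ (r y ≤ r x ∧ (r x ≤ r a ∨ r b ≤ r y))
  · rw [pathCount, assignmentCount_insert_forced h.notMem (U := U) _ h.inner_private
      h.card_inner.le (Or.inr h.card_inner), pathCount]
    · congr 1
      ext v
      simp only [Finset.mem_sdiff, mem_arc, Finset.mem_union]
      have := h.inner_notMem v
      tauto
    · intro u hu
      have := h.inner u hu
      rw [Finset.mem_inter, mem_arc, h.mem_iff]
      refine ⟨⟨Finset.mem_union_right _ hu, ?_⟩, Or.inl hu⟩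
      omega
  · have hU : ∀ v, r a ≤ r v → r v ≤ r b → v ∉ arc r (V ∪ U) x y := by
      intro v h1 h2 hv
      rw [mem_arc] at hv
      omega
    rw [pathCount, assignmentCount_insert_forced h.notMem (U := ∅) (Finset.empty_subset _)
      (by simp) (by simp) (Or.inl _), pathCount, Finset.sdiff_empty]
    · congr 1
      ext v
      have h1 := hU v
      have h2 := h.inner v
      simp only [mem_arc, Finset.mem_union] at h1 ⊢
      constructor
      · rintro ⟨hv | hv, h3⟩
        · exact ⟨hv, h3⟩
        · exact absurd ⟨Or.inr hv, h3⟩ (h1 (h2 hv).1.le (h2 hv).2.le)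
      · rintro ⟨hv, h3⟩
        exact ⟨Or.inl hv, h3⟩
    · intro v hv
      rw [Finset.mem_inter, h.mem_iff_rank hr] at hv
      have := h.inner v
      refine absurd hv.1 (hU v ?_ ?_)
      · rcases hv.2 with h1 | h1 | h1
        · exact (this h1).1.le
        · omega
        · omega
      · rcases hv.2 with h1 | h1 | h1
        · exact (this h1).2.le
        · omega
        · omega

/-- There is exactly one path between distinct vertices of an ear. -/
theorem pathCount_cell (h : IsEar r d V T c U a b) (hr : Function.Injective r) (hd : 3 ≤ d)
    (hone : pathCount r d V T b a = 1) {x y : α} (hx : x ∈ c) (hy : y ∈ c) (hxy : x ≠ y) :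
    pathCount r d (V ∪ U) (insert c T) x y = 1 := by
  have hrng : ∀ v ∈ c, r a ≤ r v ∧ r v ≤ r b := by
    intro v hv
    have h1 := h.inner v
    have h2 := h.lt
    rcases (h.mem_iff_rank hr v).1 hv with h3 | h3 | h3
    · exact ⟨(h1 h3).1.le, (h1 h3).2.le⟩
    · omega
    · omega
  have h1 := hrng x hx
  have h2 := hrng y hy
  have h3 := hr.ne hxy
  rcases lt_or_gt_of_ne h3 with h4 | h4
  · have hsub : arc r (V ∪ U) x y ⊆ U := by
      intro v hv
      rw [mem_arc, Finset.mem_union] at hv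
      refine hv.1.resolve_left fun hvV => h.outer v hvV ?_
      omega
    have hsub' : arc r (V ∪ U) x y ⊆ arc r (V ∪ U) x y ∩ c :=
      fun v hv => Finset.mem_inter.2 ⟨hv, (h.mem_iff v).2 (Or.inl (hsub hv))⟩
    rw [pathCount, assignmentCount_insert_forced h.notMem hsub'
      (fun u hu => h.inner_private u (hsub hu)) (h.card_inner ▸ Finset.card_le_card hsub)
      (Or.inl Finset.inter_subset_left), Finset.sdiff_self, assignmentCount_empty]
  · have hsd : arc r (V ∪ U) x y \ c = arc r V b a := by
      ext v
      have h5 := h.outer v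
      have h6 := h.lt
      rw [Finset.mem_sdiff, mem_arc, mem_arc, Finset.mem_union, h.mem_iff_rank hr]
      have h7 := h.inner_notMem v
      have h8 := h.inner v
      constructor
      · rintro ⟨⟨hv, h9⟩, h10⟩
        push Not at h10
        have hvV := hv.resolve_right h10.1
        have := h5 hvV
        exact ⟨hvV, by omega⟩
      · rintro ⟨hv, h9⟩
        refine ⟨⟨Or.inl hv, by omega⟩, ?_⟩
        rintro (h10 | h10 | h10)
        · exact h7 h10 hv
        · omega
        · omega
    rw [pathCount, assignmentCount_insert_of_le_card h.notMem, hsd]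
    · exact hone
    · have hsub : arc r (V ∪ U) x y ∩ c ⊆ (c.erase x).erase y := by
        intro v hv
        rw [Finset.mem_inter, mem_arc] at hv
        rw [Finset.mem_erase, Finset.mem_erase, ← hr.ne_iff, ← hr.ne_iff]
        exact ⟨by omega, by omega, hv.2⟩
      refine (Finset.card_le_card hsub).trans ?_
      rw [Finset.card_erase_of_mem (Finset.mem_erase.2 ⟨hxy.symm, hy⟩),
        Finset.card_erase_of_mem hx, h.card_cell hd]
      omega
    · have hsub : V ⊆ arc r V b a ∪ {a, b} := by
        intro v hv
        have h5 := h.outer v hv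
        simp only [Finset.mem_union, mem_arc, Finset.mem_insert, Finset.mem_singleton,
          ← hr.eq_iff]
        have h6 := h.lt
        simp only [hv, true_and]
        omega
      have h5 := (Finset.card_le_card hsub).trans (Finset.card_union_le _ _)
      have h6 := Finset.card_le_two (a := a) (b := b)
      have h7 := h.ang.count
      rw [hsd]
      omega

theorem pathCount_inner_right (h : IsEar r d V T c U a b) (hr : Function.Injective r)
    (hd : 3 ≤ d) (hone : pathCount r d V T b a = 1) {x y : α} (hx : x ∈ V) (hy : y ∈ U) :
    pathCount r d (V ∪ U) (insert c T) x y = pathCount r d V T x a + pathCount r d V T x b := by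
  have iy := h.inner y hy
  have ox := h.outer x hx
  by_cases hxa : x = a
  · subst hxa
    rw [pathCount_self hr h.ang h.left_mem, pathCount_eq_one_of_isBoundaryEdge h.isBoundaryEdge,
      h.pathCount_cell hr hd hone ((h.mem_iff _).2 (by simp)) ((h.mem_iff _).2 (by simp [hy]))
        fun he => by simp [he] at iy]
  have hxa := hr.ne hxa
  have key : ∀ v ∈ U, (v ∈ arc r (V ∪ U) x y ↔ r v < r y) := by
    intro v hv
    have := h.inner v hv
    rw [mem_arc]
    simp only [Finset.mem_union, hv, or_true, true_and]
    omega
  rw [pathCount, assignmentCount_insert_choice h.notMem (U := U.filter (fun v => r v < r y))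
    (a := a), pathCount, pathCount]
  · congr 2
    · ext v
      have h1 := key v
      have h2 := h.inner_notMem v
      have h3 := h.outer v
      have h4 := hr.eq_iff (a := v) (b := a)
      simp only [Finset.mem_sdiff, Finset.mem_insert, Finset.mem_filter, ← h4]
      by_cases hvU : v ∈ U
      · simp [hvU, h1 hvU, mem_arc, h2 hvU]
        exact fun h _ => h
      · by_cases hvV : v ∈ V
        · have := h3 hvV
          simp only [mem_arc, Finset.mem_union, hvU, hvV, true_and, false_and, or_false]
          omega
        · simp [mem_arc, hvU, hvV]
    · ext v
      have h1 := key v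
      have h2 := h.inner_notMem v
      have h3 := h.outer v
      simp only [Finset.mem_sdiff, Finset.mem_filter]
      by_cases hvU : v ∈ U
      · simp [hvU, h1 hvU, mem_arc, h2 hvU]
      · by_cases hvV : v ∈ V
        · have := h3 hvV
          simp only [mem_arc, Finset.mem_union, hvU, hvV, true_or, true_and, false_and,
            not_false_eq_true, and_true]
          omega
        · simp [mem_arc, hvU, hvV]
  · ext v
    have h1 := key v
    simp only [Finset.mem_inter, Finset.mem_insert, Finset.mem_filter, h.mem_iff_rank hr,
      ← hr.eq_iff (a := v) (b := a)]
    by_cases hvU : v ∈ U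
    · have := h.inner v hvU
      simp only [hvU, h1 hvU, true_or, true_and, and_true]
      omega
    · simp only [hvU, mem_arc, false_or, false_and, or_false, Finset.mem_union]
      constructor
      · rintro ⟨_, _⟩
        omega
      · intro hva
        have : v ∈ V := hr hva ▸ h.left_mem
        refine ⟨⟨this, ?_⟩, Or.inl hva⟩
        omega
  · intro ha
    exact (h.inner a (Finset.mem_filter.1 ha).1).1.ne rfl
  · exact fun u hu => h.inner_private u (Finset.mem_filter.1 hu).1
  · rw [← h.card_inner, Nat.succ_le_iff]
    refine Finset.card_lt_card (Finset.filter_ssubset.2 ⟨y, hy, by simp⟩)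

theorem pathCount_inner_left (h : IsEar r d V T c U a b) (hr : Function.Injective r)
    (hd : 3 ≤ d) (hone : pathCount r d V T b a = 1) {x y : α} (hx : x ∈ V) (hy : y ∈ U) :
    pathCount r d (V ∪ U) (insert c T) y x = pathCount r d V T b x + pathCount r d V T a x := by
  have iy := h.inner y hy
  have ox := h.outer x hx
  by_cases hxb : x = b
  · subst hxb
    rw [pathCount_self hr h.ang h.right_mem, pathCount_eq_one_of_isBoundaryEdge h.isBoundaryEdge,
      h.pathCount_cell hr hd hone ((h.mem_iff _).2 (by simp [hy])) ((h.mem_iff _).2 (by simp))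
        fun he => by simp [he] at iy]
  have hxb := hr.ne hxb
  have key : ∀ v ∈ U, (v ∈ arc r (V ∪ U) y x ↔ r y < r v) := by
    intro v hv
    have := h.inner v hv
    rw [mem_arc]
    simp only [Finset.mem_union, hv, or_true, true_and]
    omega
  rw [pathCount, assignmentCount_insert_choice h.notMem (U := U.filter (fun v => r y < r v))
    (a := b), pathCount, pathCount]
  · congr 2
    · ext v
      have h1 := key v
      have h2 := h.inner_notMem v
      have h3 := h.outer v
      have h4 := hr.eq_iff (a := v) (b := b)
      simp only [Finset.mem_sdiff, Finset.mem_insert, Finset.mem_filter, ← h4]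
      by_cases hvU : v ∈ U
      · simp [hvU, h1 hvU, mem_arc, h2 hvU]
        exact fun h _ => h
      · by_cases hvV : v ∈ V
        · have := h3 hvV
          simp only [mem_arc, Finset.mem_union, hvU, hvV, true_and, false_and, or_false]
          omega
        · simp [mem_arc, hvU, hvV]
    · ext v
      have h1 := key v
      have h2 := h.inner_notMem v
      have h3 := h.outer v
      simp only [Finset.mem_sdiff, Finset.mem_filter]
      by_cases hvU : v ∈ U
      · simp [hvU, h1 hvU, mem_arc, h2 hvU]
      · by_cases hvV : v ∈ V
        · have := h3 hvV
          simp only [mem_arc, Finset.mem_union, hvU, hvV, true_or, true_and, false_and,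
            not_false_eq_true, and_true]
          omega
        · simp [mem_arc, hvU, hvV]
  · ext v
    have h1 := key v
    simp only [Finset.mem_inter, Finset.mem_insert, Finset.mem_filter, h.mem_iff_rank hr,
      ← hr.eq_iff (a := v) (b := b)]
    by_cases hvU : v ∈ U
    · have := h.inner v hvU
      simp only [hvU, h1 hvU, true_or, true_and, and_true]
      omega
    · simp only [hvU, mem_arc, false_or, false_and, or_false, Finset.mem_union]
      constructor
      · rintro ⟨_, _⟩
        omega
      · intro hvb
        have : v ∈ V := hr hvb ▸ h.right_mem
        refine ⟨⟨this, ?_⟩, Or.inr hvb⟩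
        omega
  · intro hb
    exact (h.inner b (Finset.mem_filter.1 hb).1).2.ne rfl
  · exact fun u hu => h.inner_private u (Finset.mem_filter.1 hu).1
  · rw [← h.card_inner, Nat.succ_le_iff]
    refine Finset.card_lt_card (Finset.filter_ssubset.2 ⟨y, hy, by simp⟩)

/-- A boundary edge of the enlarged polygon is either an old boundary edge other than the one the
ear is glued to, or an edge of the ear. -/
theorem edge_cases (h : IsEar r d V T c U a b) (hr : Function.Injective r) (hd : 3 ≤ d)
    {x y : α} (hxy : IsBoundaryEdge r (V ∪ U) x y) :
    (IsBoundaryEdge r V x y ∧ x ≠ a) ∨ ((x = a ∨ x ∈ U) ∧ (y = b ∨ y ∈ U)) := by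
  have hab := h.lt
  have hne := hr.ne hxy.2.2.1
  have ha := hxy.notMem_arc (Finset.mem_union_left U h.left_mem)
  have hb := hxy.notMem_arc (Finset.mem_union_left U h.right_mem)
  obtain ⟨u, hu⟩ : U.Nonempty := Finset.card_pos.1 (by rw [h.card_inner]; omega)
  have hu' := hxy.notMem_arc (Finset.mem_union_right V hu)
  have iu := h.inner u hu
  rcases Finset.mem_union.1 hxy.1 with hx | hx
  · have ox := h.outer x hx
    rcases Finset.mem_union.1 hxy.2.1 with hy | hy
    · have oy := h.outer y hy
      left
      refine ⟨⟨hx, hy, hxy.2.2.1, ?_⟩, ?_⟩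
      · ext v
        simp only [mem_arc, Finset.notMem_empty, iff_false, not_and]
        exact fun hv => hxy.notMem_arc (Finset.mem_union_left U hv)
      · rw [← hr.ne_iff]
        omega
    · have iy := h.inner y hy
      right
      rw [← hr.eq_iff]
      exact ⟨Or.inl (by omega), Or.inr hy⟩
  · have ix := h.inner x hx
    right
    refine ⟨Or.inr hx, ?_⟩
    rcases Finset.mem_union.1 hxy.2.1 with hy | hy
    · have oy := h.outer y hy
      rw [← hr.eq_iff]
      exact Or.inl (by omega)
    · exact Or.inr hy

end IsEar

theorem IsCombAngulation.pathCount_and_det (hr : Function.Injective r) (hd : 3 ≤ d)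
    (h : IsCombAngulation r d V T) :
    (∀ x x', IsBoundaryEdge r V x x' → pathCount r d V T x' x = 1) ∧
    ∀ x x' y y', IsBoundaryEdge r V x x' → IsBoundaryEdge r V y y' → x ≠ y →
      (pathCount r d V T x y : ℤ) * pathCount r d V T x' y'
        - pathCount r d V T x y' * pathCount r d V T x' y = 0 ∨
      (pathCount r d V T x y : ℤ) * pathCount r d V T x' y'
        - pathCount r d V T x y' * pathCount r d V T x' y = 1 := by
  induction hk : T.card generalizing T V with
  | zero =>
    have hcard : V.card = 2 := by rw [← h.count, hk]; simp
    have hpair : ∀ x ∈ V, ∀ y ∈ V, x ≠ y → ∀ v ∈ V, v = x ∨ v = y := by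
      intro x hx y hy hxy v hv
      have hsub : ({x, y} : Finset α) ⊆ V := by
        intro z hz
        rw [Finset.mem_insert, Finset.mem_singleton] at hz
        rcases hz with rfl | rfl <;> assumption
      rw [← Finset.eq_of_subset_of_card_le hsub (by rw [hcard, Finset.card_pair hxy])] at hv
      simpa using hv
    have hone : ∀ x ∈ V, ∀ y ∈ V, x ≠ y → pathCount r d V T x y = 1 := by
      intro x hx y hy hxy
      refine pathCount_eq_one_of_isBoundaryEdge ⟨hx, hy, hxy, ?_⟩
      ext v
      simp only [mem_arc, Finset.notMem_empty, iff_false, not_and]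
      intro hv
      have := hr.ne hxy
      rcases hpair x hx y hy hxy v hv with rfl | rfl <;> omega
    refine ⟨fun x x' hx => hone x' hx.2.1 x hx.1 hx.2.2.1.symm, ?_⟩
    intro x x' y y' hx hy hxy
    have hx' : x' = y := (hpair x hx.1 y hy.1 hxy x' hx.2.1).resolve_left hx.2.2.1.symm
    have hy' : y' = x := (hpair x hx.1 y hy.1 hxy y' hy.2.1).resolve_right hy.2.2.1.symm
    subst hx' hy'
    rw [hone _ hx.1 _ hy.1 hxy, hone _ hy.1 _ hx.1 hxy.symm, pathCount_self hr h hx.1]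
    right
    norm_num
  | succ k ih =>
    obtain ⟨c, hc, V', U, a, b, hear, rfl⟩ :=
      h.exists_isEar hr hd (Finset.card_pos.1 (by omega))
    obtain ⟨ih1, ih2⟩ := ih hear.ang (by rw [Finset.card_erase_of_mem hc]; omega)
    obtain ⟨T', hT'⟩ : ∃ T', T' = T.erase c := ⟨_, rfl⟩
    rw [← hT'] at hear ih1 ih2
    have hTins : T = insert c T' := by rw [hT', Finset.insert_erase hc]
    subst hTins
    have hab := hear.isBoundaryEdge
    have hone := ih1 a b hab
    have memc_left : ∀ {x}, x = a ∨ x ∈ U → x ∈ c := fun hx => by rw [hear.mem_iff]; tauto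
    have memc_right : ∀ {x}, x = b ∨ x ∈ U → x ∈ c := fun hx => by rw [hear.mem_iff]; tauto
    constructor
    · intro x x' hx
      rcases hear.edge_cases hr hd hx with ⟨hold, _⟩ | ⟨h1, h2⟩
      · rw [hear.pathCount_outer hr hold.2.1 hold.1, ih1 x x' hold]
      · exact hear.pathCount_cell hr hd hone (memc_right h2) (memc_left h1) hx.2.2.1.symm
    · intro x x' y y' hx hy hxy
      rcases hear.edge_cases hr hd hx with ⟨hxo, hxa⟩ | ⟨hx1, hx2⟩
      · rcases hear.edge_cases hr hd hy with ⟨hyo, -⟩ | ⟨hy1, hy2⟩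
        · rw [hear.pathCount_outer hr hxo.1 hyo.1, hear.pathCount_outer hr hxo.2.1 hyo.2.1,
            hear.pathCount_outer hr hxo.1 hyo.2.1, hear.pathCount_outer hr hxo.2.1 hyo.1]
          exact ih2 x x' y y' hxo hyo hxy
        · have key := ih2 x x' a b hxo hab hxa
          have hva : ∀ z ∈ V', pathCount r d (V' ∪ U) (insert c T') z a = pathCount r d V' T' z a :=
            fun z hz => hear.pathCount_outer hr hz hear.left_mem
          have hvb : ∀ z ∈ V', pathCount r d (V' ∪ U) (insert c T') z b = pathCount r d V' T' z b :=
            fun z hz => hear.pathCount_outer hr hz hear.right_mem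
          rcases hy1 with rfl | hy1 <;> rcases hy2 with rfl | hy2
          · rwa [hva x hxo.1, hva x' hxo.2.1, hvb x hxo.1, hvb x' hxo.2.1]
          · rw [hva x hxo.1, hva x' hxo.2.1, hear.pathCount_inner_right hr hd hone hxo.1 hy2,
              hear.pathCount_inner_right hr hd hone hxo.2.1 hy2]
            push_cast
            ring_nf at key ⊢
            exact key
          · rw [hvb x hxo.1, hvb x' hxo.2.1, hear.pathCount_inner_right hr hd hone hxo.1 hy1,
              hear.pathCount_inner_right hr hd hone hxo.2.1 hy1]
            push_cast
            ring_nf at key ⊢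
            exact key
          · left
            rw [hear.pathCount_inner_right hr hd hone hxo.1 hy1,
              hear.pathCount_inner_right hr hd hone hxo.2.1 hy1,
              hear.pathCount_inner_right hr hd hone hxo.1 hy2,
              hear.pathCount_inner_right hr hd hone hxo.2.1 hy2]
            ring
      · rcases hear.edge_cases hr hd hy with ⟨hyo, hya⟩ | ⟨hy1, hy2⟩
        · have key := ih2 a b y y' hab hyo hya.symm
          have hva : ∀ z ∈ V', pathCount r d (V' ∪ U) (insert c T') a z = pathCount r d V' T' a z :=
            fun z hz => hear.pathCount_outer hr hear.left_mem hz
          have hvb : ∀ z ∈ V', pathCount r d (V' ∪ U) (insert c T') b z = pathCount r d V' T' b z :=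
            fun z hz => hear.pathCount_outer hr hear.right_mem hz
          rcases hx1 with rfl | hx1 <;> rcases hx2 with rfl | hx2
          · rwa [hva y hyo.1, hva y' hyo.2.1, hvb y hyo.1, hvb y' hyo.2.1]
          · rw [hva y hyo.1, hva y' hyo.2.1, hear.pathCount_inner_left hr hd hone hyo.1 hx2,
              hear.pathCount_inner_left hr hd hone hyo.2.1 hx2]
            push_cast
            ring_nf at key ⊢
            exact key
          · rw [hvb y hyo.1, hvb y' hyo.2.1, hear.pathCount_inner_left hr hd hone hyo.1 hx1,
              hear.pathCount_inner_left hr hd hone hyo.2.1 hx1]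
            push_cast
            ring_nf at key ⊢
            exact key
          · left
            rw [hear.pathCount_inner_left hr hd hone hyo.1 hx1,
              hear.pathCount_inner_left hr hd hone hyo.2.1 hx1,
              hear.pathCount_inner_left hr hd hone hyo.1 hx2,
              hear.pathCount_inner_left hr hd hone hyo.2.1 hx2]
            ring
        · have hval : ∀ z ∈ c, ∀ w ∈ c,
              pathCount r d (V' ∪ U) (insert c T') z w = if z = w then 0 else 1 := by
            intro z hz w hw
            split_ifs with hzw
            · subst hzw
              exact pathCount_self hr h (h.subset c hc hz)
            · exact hear.pathCount_cell hr hd hone hz hw hzw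
          rw [hval x (memc_left hx1) y (memc_left hy1),
            hval x' (memc_right hx2) y' (memc_right hy2),
            hval x (memc_left hx1) y' (memc_right hy2),
            hval x' (memc_right hx2) y (memc_left hy1), if_neg hxy,
            if_neg (hx.right_ne hr hy hxy)]
          split_ifs <;> simp

end Arcs

section Geometry

/-- Twice the signed area of the triangle `p q s`. -/
def orient (p q s : ℝ × ℝ) : ℝ :=
  (q.1 - p.1) * (s.2 - p.2) - (q.2 - p.2) * (s.1 - p.1)

theorem orient_circle (α β γ : ℝ) :
    orient (Real.cos α, Real.sin α) (Real.cos β, Real.sin β) (Real.cos γ, Real.sin γ) =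
      4 * Real.sin ((β - α) / 2) * Real.sin ((γ - β) / 2) * Real.sin ((γ - α) / 2) := by
  obtain ⟨p, hp⟩ : ∃ p, p = (β - α) / 2 := ⟨_, rfl⟩
  obtain ⟨q, hq⟩ : ∃ q, q = (γ - β) / 2 := ⟨_, rfl⟩
  have h1 : orient (Real.cos α, Real.sin α) (Real.cos β, Real.sin β)
      (Real.cos γ, Real.sin γ) =
      Real.sin (β - α) + Real.sin (γ - β) - Real.sin (γ - α) := by
    rw [orient, Real.sin_sub, Real.sin_sub, Real.sin_sub]
    ring
  have h2 : (γ - α) / 2 = p + q := by rw [hp, hq]; ring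
  have h3 : β - α = 2 * p := by rw [hp]; ring
  have h4 : γ - β = 2 * q := by rw [hq]; ring
  have h5 : γ - α = 2 * p + 2 * q := by rw [hp, hq]; ring
  rw [h1, h2, ← hp, ← hq, h3, h4, h5, Real.sin_add, Real.sin_add, Real.sin_two_mul,
    Real.sin_two_mul, Real.cos_two_mul, Real.cos_two_mul]
  have hp' := Real.sin_sq_add_cos_sq p
  have hq' := Real.sin_sq_add_cos_sq q
  linear_combination (-4 * Real.sin p * Real.cos p) * hq' - (4 * Real.sin q * Real.cos q) * hp'

theorem sin_half_angle_pos {n : ℕ} {x y : ℕ} (hxy : x < y) (hy : y < n) :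
    0 < Real.sin ((2 * Real.pi * y / n - 2 * Real.pi * x / n) / 2) := by
  have hn : (0 : ℝ) < n := by exact_mod_cast (by omega : 0 < n)
  have h1 : (x : ℝ) < y := by exact_mod_cast hxy
  have h2 : (y : ℝ) < n := by exact_mod_cast hy
  have h3 : (0 : ℝ) ≤ x := Nat.cast_nonneg x
  have h4 : (2 * Real.pi * y / n - 2 * Real.pi * x / n) / 2 = Real.pi * ((y - x) / n) := by
    field_simp
  rw [h4]
  apply Real.sin_pos_of_pos_of_lt_pi
  · exact mul_pos Real.pi_pos (div_pos (by linarith) hn)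
  · have : ((y : ℝ) - x) / n < 1 := by rw [div_lt_one hn]; linarith
    nlinarith [Real.pi_pos]

theorem orient_vtx_pos {n : ℕ} [NeZero n] {x y z : ZMod n} (hxy : x.val < y.val)
    (hyz : y.val < z.val) : 0 < orient (vtx n x) (vtx n y) (vtx n z) := by
  rw [vtx, vtx, vtx, orient_circle]
  have := sin_half_angle_pos hxy (ZMod.val_lt y)
  have := sin_half_angle_pos hyz (ZMod.val_lt z)
  have := sin_half_angle_pos (hxy.trans hyz) (ZMod.val_lt z)
  positivity

theorem interior_convexHull_nonempty {s : Set (ℝ × ℝ)} {p q t : ℝ × ℝ} (hp : p ∈ s)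
    (hq : q ∈ s) (ht : t ∈ s) (h : 0 < orient p q t) : (interior (convexHull ℝ s)).Nonempty := by
  have hopen : IsOpen {z : ℝ × ℝ | 0 < orient p q z ∧ 0 < orient q t z ∧ 0 < orient t p z} := by
    have hcont : ∀ p q, Continuous (orient p q) := fun p q => by unfold orient; fun_prop
    exact (isOpen_lt continuous_const (hcont p q)).inter
      ((isOpen_lt continuous_const (hcont q t)).inter (isOpen_lt continuous_const (hcont t p)))
  have hsub : {z : ℝ × ℝ | 0 < orient p q z ∧ 0 < orient q t z ∧ 0 < orient t p z} ⊆
      convexHull ℝ s := by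
    rintro z ⟨h1, h2, h3⟩
    have hsum : orient q t z + orient t p z + orient p q z = orient p q t := by
      unfold orient; ring
    have hz : z = (orient q t z / orient p q t) • p + (orient t p z / orient p q t) • q +
        (orient p q z / orient p q t) • t := by
      have h' := h.ne'
      ext
      · simp only [Prod.fst_add, Prod.smul_fst, smul_eq_mul]
        field_simp
        unfold orient
        ring
      · simp only [Prod.snd_add, Prod.smul_snd, smul_eq_mul]
        field_simp
        unfold orient
        ring
    rw [hz]
    have hconv := convex_convexHull ℝ s
    have hmem : ∀ i, ![p, q, t] i ∈ convexHull ℝ s := by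
      intro i
      fin_cases i <;> simp <;> apply subset_convexHull <;> assumption
    have hmem := hconv.sum_mem (t := Finset.univ) (w := ![orient q t z / orient p q t,
      orient t p z / orient p q t, orient p q z / orient p q t]) (z := ![p, q, t])
      (by
        intro i _
        fin_cases i <;> simp <;> positivity)
      (by
        simp only [Fin.sum_univ_three, Matrix.cons_val]
        rw [← add_div, ← add_div, hsum, div_self h.ne'])
      (fun i _ => hmem i)
    simpa [Fin.sum_univ_three] using hmem
  refine ⟨(1 / 3 : ℝ) • p + (1 / 3 : ℝ) • q + (1 / 3 : ℝ) • t,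
    interior_maximal hsub hopen ⟨?_, ?_, ?_⟩⟩ <;>
  · unfold orient at h ⊢
    simp only [Prod.fst_add, Prod.smul_fst, Prod.snd_add, Prod.smul_snd, smul_eq_mul]
    nlinarith

theorem exists_lt_lt_val {n : ℕ} [NeZero n] {c : Finset (ZMod n)} (hc : 3 ≤ c.card) :
    ∃ x ∈ c, ∃ y ∈ c, ∃ z ∈ c, x.val < y.val ∧ y.val < z.val := by
  have hr := ZMod.val_injective n
  have hcne : c.Nonempty := Finset.card_pos.1 (by omega)
  obtain ⟨a, ha, hamin⟩ := Finset.exists_min_image c ZMod.val hcne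
  obtain ⟨b, hb, hbmax⟩ := Finset.exists_max_image c ZMod.val hcne
  obtain ⟨m, hm, hma⟩ : ∃ m ∈ c, m ∉ ({a, b} : Finset (ZMod n)) := by
    by_contra! h
    have h1 := Finset.card_le_card (show c ⊆ {a, b} from h)
    have h2 := Finset.card_le_two (a := a) (b := b)
    omega
  simp only [Finset.mem_insert, Finset.mem_singleton, not_or] at hma
  exact ⟨a, ha, m, hm, b, hb, lt_of_le_of_ne (hamin m hm) fun h => hma.1 (hr h).symm,
    lt_of_le_of_ne (hbmax m hm) fun h => hma.2 (hr h)⟩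

theorem interior_cellHull_nonempty {n : ℕ} [NeZero n] {c : Finset (ZMod n)} (hc : 3 ≤ c.card) :
    (interior (cellHull n c)).Nonempty := by
  obtain ⟨x, hx, y, hy, z, hz, hxy, hyz⟩ := exists_lt_lt_val hc
  exact interior_convexHull_nonempty (Set.mem_image_of_mem _ hx) (Set.mem_image_of_mem _ hy)
    (Set.mem_image_of_mem _ hz) (orient_vtx_pos hxy hyz)

theorem exists_separating {n : ℕ} [NeZero n] {c c' : Finset (ZMod n)} (hc : 3 ≤ c.card)
    (hc' : 3 ≤ c'.card) (h : interior (cellHull n c) ∩ interior (cellHull n c') = ∅) :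
    ∃ A B u : ℝ, (A ≠ 0 ∨ B ≠ 0) ∧ (∀ x ∈ c, A * (vtx n x).1 + B * (vtx n x).2 ≤ u) ∧
      ∀ x ∈ c', u ≤ A * (vtx n x).1 + B * (vtx n x).2 := by
  have hconv : Convex ℝ (cellHull n c) := convex_convexHull ℝ _
  have hconv' : Convex ℝ (cellHull n c') := convex_convexHull ℝ _
  have hne := interior_cellHull_nonempty hc
  have hne' := interior_cellHull_nonempty hc'
  obtain ⟨f, u, hf, hf'⟩ := geometric_hahn_banach_open hconv.interior isOpen_interior
    hconv'.interior (Set.disjoint_iff_inter_eq_empty.2 h)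
  have hval : ∀ p : ℝ × ℝ, f p = f (1, 0) * p.1 + f (0, 1) * p.2 := by
    intro p
    have : p = p.1 • ((1, 0) : ℝ × ℝ) + p.2 • ((0, 1) : ℝ × ℝ) := by ext <;> simp
    conv_lhs => rw [this, map_add, map_smul, map_smul]
    simp only [smul_eq_mul]
    ring
  refine ⟨f (1, 0), f (0, 1), u, ?_, ?_, ?_⟩
  · by_contra! h0
    obtain ⟨p, hp⟩ := hne
    obtain ⟨q, hq⟩ := hne'
    have h1 := hf p hp
    have h2 := hf' q hq
    rw [hval, h0.1, h0.2] at h1 h2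
    linarith
  · intro x hx
    rw [← hval]
    have hmem : vtx n x ∈ closure (interior (cellHull n c)) := by
      rw [hconv.closure_interior_eq_closure_of_nonempty_interior hne]
      exact subset_closure (subset_convexHull ℝ _ (Set.mem_image_of_mem _ hx))
    exact closure_minimal (fun p hp => (hf p hp).le)
      (isClosed_le f.continuous continuous_const) hmem
  · intro x hx
    rw [← hval]
    have hmem : vtx n x ∈ closure (interior (cellHull n c')) := by
      rw [hconv'.closure_interior_eq_closure_of_nonempty_interior hne']
      exact subset_closure (subset_convexHull ℝ _ (Set.mem_image_of_mem _ hx))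
    exact closure_minimal (fun p hp => hf' p hp)
      (isClosed_le continuous_const f.continuous) hmem

/-- Cells whose chords cross are not separated by a line. -/
theorem noncrossing_of_interior_disjoint {n : ℕ} [NeZero n] {c c' : Finset (ZMod n)}
    (hc : 3 ≤ c.card) (hc' : 3 ≤ c'.card)
    (h : interior (cellHull n c) ∩ interior (cellHull n c') = ∅) {x y x' y' : ZMod n}
    (hx : x ∈ c) (hy : y ∈ c') (hx' : x' ∈ c) (hy' : y' ∈ c') (h1 : x.val < y.val)
    (h2 : y.val < x'.val) (h3 : x'.val < y'.val) : False := by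
  obtain ⟨A, B, u, hAB, hle, hge⟩ := exists_separating hc hc' h
  have o1 := orient_vtx_pos h2 h3
  have o2 := orient_vtx_pos (h1.trans h2) h3
  have o3 := orient_vtx_pos h1 (h2.trans h3)
  have o4 := orient_vtx_pos h1 h2
  have e1 := hle x hx
  have e2 := hge y hy
  have e3 := hle x' hx'
  have e4 := hge y' hy'
  generalize vtx n x = p at *
  generalize vtx n y = q at *
  generalize vtx n x' = p' at *
  generalize vtx n y' = q' at *
  have key : orient q p' q' * (A * p.1 + B * p.2 - u) + orient p q q' * (A * p'.1 + B * p'.2 - u) =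
      orient p p' q' * (A * q.1 + B * q.2 - u) + orient p q p' * (A * q'.1 + B * q'.2 - u) := by
    unfold orient; ring
  have k1 : orient q p' q' * (A * p.1 + B * p.2 - u) ≤ 0 :=
    mul_nonpos_of_nonneg_of_nonpos o1.le (by linarith)
  have k2 : orient p q q' * (A * p'.1 + B * p'.2 - u) ≤ 0 :=
    mul_nonpos_of_nonneg_of_nonpos o3.le (by linarith)
  have k3 : 0 ≤ orient p p' q' * (A * q.1 + B * q.2 - u) := mul_nonneg o2.le (by linarith)
  have k4 : 0 ≤ orient p q p' * (A * q'.1 + B * q'.2 - u) := mul_nonneg o4.le (by linarith)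
  have z1 := (mul_eq_zero.1 (le_antisymm k1 (by linarith))).resolve_left o1.ne'
  have z2 := (mul_eq_zero.1 (le_antisymm k2 (by linarith))).resolve_left o3.ne'
  have z3 := (mul_eq_zero.1 (le_antisymm (by linarith) k3)).resolve_left o2.ne'
  have hA : orient p q p' * A = 0 := by
    unfold orient
    linear_combination (p'.2 - p.2) * (z3 - z1) - (q.2 - p.2) * (z2 - z1)
  have hB : orient p q p' * B = 0 := by
    unfold orient
    linear_combination (q.1 - p.1) * (z2 - z1) - (p'.1 - p.1) * (z3 - z1)
  rcases hAB with h0 | h0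
  · exact h0 ((mul_eq_zero.1 hA).resolve_left o4.ne')
  · exact h0 ((mul_eq_zero.1 hB).resolve_left o4.ne')

theorem vtx_inner_lt_one {n : ℕ} [NeZero n] {x y : ZMod n} (h : x ≠ y) :
    (vtx n x).1 * (vtx n y).1 + (vtx n x).2 * (vtx n y).2 < 1 := by
  wlog hlt : x.val < y.val generalizing x y
  · have := this h.symm (lt_of_le_of_ne (not_lt.1 hlt) fun h' => h (ZMod.val_injective n h'.symm))
    linarith
  have hpos := sin_half_angle_pos hlt (ZMod.val_lt y)
  simp only [vtx]
  have h1 := Real.cos_sub (2 * Real.pi * y.val / n) (2 * Real.pi * x.val / n)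
  have h2 := Real.cos_two_mul ((2 * Real.pi * y.val / n - 2 * Real.pi * x.val / n) / 2)
  rw [mul_div_cancel₀ _ (two_ne_zero)] at h2
  have h3 := Real.sin_sq_add_cos_sq ((2 * Real.pi * y.val / n - 2 * Real.pi * x.val / n) / 2)
  nlinarith

theorem mem_of_vtx_mem_cellHull {n : ℕ} [NeZero n] {c : Finset (ZMod n)} {v : ZMod n}
    (h : vtx n v ∈ cellHull n c) : v ∈ c := by
  by_contra hv
  have hsub : cellHull n c ⊆
      {p | (vtx n v).1 * p.1 + (vtx n v).2 * p.2 < 1} := by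
    refine convexHull_min ?_ ?_
    · rintro _ ⟨x, hx, rfl⟩
      exact vtx_inner_lt_one fun h => hv (h ▸ hx)
    · refine convex_halfSpace_lt (f := fun p : ℝ × ℝ =>
        (vtx n v).1 * p.1 + (vtx n v).2 * p.2) ⟨?_, ?_⟩ 1
      · intro p q
        simp only [Prod.fst_add, Prod.snd_add]
        ring
      · intro t p
        simp only [Prod.smul_fst, Prod.smul_snd, smul_eq_mul]
        ring
  have h1 := hsub h
  have h2 := Real.sin_sq_add_cos_sq (2 * Real.pi * v.val / n)
  simp only [Set.mem_ofPred_eq, vtx] at h1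
  nlinarith

/-- A convex hull all of whose generators other than `v` lie strictly on one side of a line
through `v` meets this line only in `v`. -/
theorem eq_of_mem_convexHull {s : Set (ℝ × ℝ)} {v p : ℝ × ℝ} {A B : ℝ}
    (hs : ∀ x ∈ s, A * (x.1 - v.1) + B * (x.2 - v.2) < 0 ∨ x = v) (hp : p ∈ convexHull ℝ s)
    (h0 : A * (p.1 - v.1) + B * (p.2 - v.2) = 0) : p = v := by
  have hconv : Convex ℝ {x : ℝ × ℝ | A * (x.1 - v.1) + B * (x.2 - v.2) < 0 ∨ x = v} := by
    refine convex_iff_forall_pos.2 fun x hx y hy s t hs ht hst => ?_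
    have hid : A * ((s • x + t • y).1 - v.1) + B * ((s • x + t • y).2 - v.2) =
        s * (A * (x.1 - v.1) + B * (x.2 - v.2)) + t * (A * (y.1 - v.1) + B * (y.2 - v.2)) := by
      simp only [Prod.fst_add, Prod.smul_fst, Prod.snd_add, Prod.smul_snd, smul_eq_mul]
      linear_combination (A * v.1 + B * v.2) * hst
    rw [Set.mem_ofPred_eq, hid]
    rcases hx with hx | rfl
    · rcases hy with hy | rfl
      · left; nlinarith
      · left; simp only [sub_self]; nlinarith
    · rcases hy with hy | rfl
      · left; simp only [sub_self]; nlinarith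
      · right; rw [← add_smul, hst, one_smul]
  rcases convexHull_min hs hconv hp with h | h
  · exact absurd h0 h.ne
  · exact h

/-- Every vertex off the boundary edge `(n - 1, 0)` is an inner vertex, as seen from this edge, of
some cell. -/
theorem exists_cell_inner {n d : ℕ} [NeZero n] {T : Finset (Finset (ZMod n))}
    (hT : IsDAngulation n d T) {s v e : ZMod n} (hs : s.val = 0) (he : e.val + 1 = n)
    (hsv : s.val < v.val) (hve : v.val < e.val) :
    ∃ c ∈ T, v ∈ c ∧ (∃ x ∈ c, x.val < v.val) ∧ ∃ y ∈ c, v.val < y.val := by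
  obtain ⟨q, hq⟩ : ∃ q, q = (1 / 2 : ℝ) • vtx n s + (1 / 2 : ℝ) • vtx n e := ⟨_, rfl⟩
  obtain ⟨p, hp⟩ : ∃ p : ℕ → ℝ × ℝ, p = fun N : ℕ =>
    (1 - 1 / ((N : ℝ) + 1)) • vtx n v + (1 / ((N : ℝ) + 1)) • q := ⟨_, rfl⟩
  have hlim : Filter.Tendsto p Filter.atTop (nhds (vtx n v)) := by
    have h0 := tendsto_one_div_add_atTop_nhds_zero_nat (𝕜 := ℝ)
    have := ((tendsto_const_nhds (x := (1 : ℝ))).sub h0).smul_const (vtx n v) |>.add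
      (h0.smul_const q)
    rw [hp]
    simpa using this
  have hmem : ∀ N, ∃ c ∈ T, p N ∈ cellHull n c := by
    intro N
    have hP : Convex ℝ (convexHull ℝ (Set.range (vtx n))) := convex_convexHull ℝ _
    have hv : ∀ x, vtx n x ∈ convexHull ℝ (Set.range (vtx n)) :=
      fun x => subset_convexHull ℝ _ (Set.mem_range_self x)
    have hq' : q ∈ convexHull ℝ (Set.range (vtx n)) := by
      rw [hq]
      exact hP (hv s) (hv e) (by norm_num) (by norm_num) (by norm_num)
    have hle : 1 / ((N : ℝ) + 1) ≤ 1 := by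
      rw [div_le_one (by positivity)]
      linarith [Nat.cast_nonneg (α := ℝ) N]
    have : p N ∈ convexHull ℝ (Set.range (vtx n)) := by
      rw [hp]
      exact hP (hv v) hq' (by linarith) (by positivity) (by ring)
    rw [← hT.2.1] at this
    simpa using this
  have hfreq : ∃ c ∈ T, ∃ᶠ N in Filter.atTop, p N ∈ cellHull n c := by
    by_contra! hcon
    have h1 : ∀ᶠ N in Filter.atTop, ∀ c ∈ T, p N ∉ cellHull n c :=
      (Filter.eventually_all_finset T).2 hcon
    obtain ⟨N, hN⟩ := h1.exists
    obtain ⟨c, hc, hpc⟩ := hmem N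
    exact hN c hc hpc
  obtain ⟨c, hc, hcfreq⟩ := hfreq
  have hclosed : IsClosed (cellHull n c) := (c.finite_toSet.image (vtx n)).isClosed_convexHull ℝ
  have hvc : v ∈ c := mem_of_vtx_mem_cellHull (hclosed.mem_of_frequently_of_tendsto hcfreq hlim)
  obtain ⟨N, hN⟩ := hcfreq.exists
  have ho := orient_vtx_pos hsv hve
  have hqv : q ≠ vtx n v := by
    intro h
    rw [← h, hq] at ho
    unfold orient at ho
    simp only [Prod.fst_add, Prod.smul_fst, Prod.snd_add, Prod.smul_snd, smul_eq_mul] at ho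
    nlinarith
  have hpv : p N ≠ vtx n v := by
    intro h
    apply hqv
    have h1 : (1 / ((N : ℝ) + 1)) • (q - vtx n v) = 0 := by
      rw [hp] at h
      rw [smul_sub, sub_eq_zero]
      have h2 : vtx n v = (1 - 1 / ((N : ℝ) + 1)) • vtx n v + (1 / ((N : ℝ) + 1)) • vtx n v := by
        rw [← add_smul]; simp
      exact add_left_cancel (h.trans h2)
    have h2 : (1 / ((N : ℝ) + 1)) ≠ 0 := by positivity
    exact sub_eq_zero.1 ((smul_eq_zero.1 h1).resolve_left h2)
  have hline : (q.2 - (vtx n v).2) * ((p N).1 - (vtx n v).1) +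
      (-(q.1 - (vtx n v).1)) * ((p N).2 - (vtx n v).2) = 0 := by
    rw [hp]
    simp only [Prod.fst_add, Prod.smul_fst, Prod.snd_add, Prod.smul_snd, smul_eq_mul]
    ring
  refine ⟨c, hc, hvc, ?_, ?_⟩
  · by_contra! hcon
    refine hpv (eq_of_mem_convexHull (A := -(q.2 - (vtx n v).2)) (B := q.1 - (vtx n v).1) ?_ hN
      (by linarith))
    rintro _ ⟨x, hx, rfl⟩
    by_cases hxv : x = v
    · right; rw [hxv]
    left
    have h1 : v.val < x.val :=
      lt_of_le_of_ne (hcon x hx) fun h => hxv (ZMod.val_injective n h).symm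
    have o1 := orient_vtx_pos hsv h1
    have o2 : 0 ≤ orient (vtx n v) (vtx n x) (vtx n e) := by
      rcases eq_or_ne x e with rfl | hne
      · unfold orient; nlinarith
      · have h2 : x.val ≠ e.val := fun h => hne (ZMod.val_injective n h)
        have h3 := ZMod.val_lt x
        exact (orient_vtx_pos h1 (by omega)).le
    rw [hq]
    unfold orient at o1 o2
    simp only [Prod.fst_add, Prod.smul_fst, Prod.snd_add, Prod.smul_snd, smul_eq_mul]
    nlinarith
  · by_contra! hcon
    refine hpv (eq_of_mem_convexHull (A := q.2 - (vtx n v).2) (B := -(q.1 - (vtx n v).1)) ?_ hN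
      hline)
    rintro _ ⟨x, hx, rfl⟩
    by_cases hxv : x = v
    · right; rw [hxv]
    left
    have h1 : x.val < v.val := lt_of_le_of_ne (hcon x hx) fun h => hxv (ZMod.val_injective n h)
    have o1 := orient_vtx_pos h1 hve
    have o2 : 0 ≤ orient (vtx n s) (vtx n x) (vtx n v) := by
      rcases eq_or_ne x s with rfl | hne
      · unfold orient; nlinarith
      · have h2 : x.val ≠ s.val := fun h => hne (ZMod.val_injective n h)
        exact (orient_vtx_pos (by omega) h1).le
    rw [hq]
    unfold orient at o1 o2
    simp only [Prod.fst_add, Prod.smul_fst, Prod.snd_add, Prod.smul_snd, smul_eq_mul]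
    nlinarith

end Geometry

section Polygon

variable {n : ℕ} [NeZero n]

theorem IsDAngulation.isCombAngulation {d : ℕ} (hd : 3 ≤ d) (hn : 3 ≤ n)
    {T : Finset (Finset (ZMod n))} (hT : IsDAngulation n d T) :
    IsCombAngulation ZMod.val d Finset.univ T := by
  have hnc : Noncrossing ZMod.val T := by
    intro c hc c' hc' hne x hx y hy x' hx' y' hy'
    exact noncrossing_of_interior_disjoint (by rw [hT.1 c hc]; exact hd)
      (by rw [hT.1 c' hc']; exact hd) (hT.2.2 c hc c' hc' hne) hx hy hx' hy'
  have hr := ZMod.val_injective n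
  have hcardn : (Finset.univ : Finset (ZMod n)).card = n := by
    rw [Finset.card_univ, ZMod.card]
  refine ⟨hnc, hT.1, fun c _ => Finset.subset_univ c, le_antisymm
    (hnc.card_mul_add_two_le hr hd hT.1 (fun c _ => Finset.subset_univ c) (by omega)) ?_⟩
  have he : ((n - 1 : ℕ) : ZMod n).val = n - 1 := ZMod.val_cast_of_lt (by omega)
  have hs : (0 : ZMod n).val = 0 := ZMod.val_zero
  obtain ⟨e, hee⟩ : ∃ e, e = ((n - 1 : ℕ) : ZMod n) := ⟨_, rfl⟩
  rw [← hee] at he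
  have hsub : Finset.univ \ {0, e} ⊆ T.biUnion fun c =>
      c.filter fun v => (∃ x ∈ c, x.val < v.val) ∧ ∃ y ∈ c, v.val < y.val := by
    intro v hv
    simp only [Finset.mem_sdiff, Finset.mem_univ, true_and, Finset.mem_insert,
      Finset.mem_singleton, not_or, ← hr.eq_iff (a := v)] at hv
    have := ZMod.val_lt v
    obtain ⟨c, hc, hvc, h⟩ := exists_cell_inner hT (v := v) hs (e := e) (by omega)
      (by omega) (by omega)
    exact Finset.mem_biUnion.2 ⟨c, hc, Finset.mem_filter.2 ⟨hvc, h⟩⟩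
  have hinner : ∀ c ∈ T, (c.filter fun v => (∃ x ∈ c, x.val < v.val) ∧
      ∃ y ∈ c, v.val < y.val).card ≤ d - 2 := by
    intro c hc
    have hcne : c.Nonempty := Finset.card_pos.1 (by rw [hT.1 c hc]; omega)
    obtain ⟨a, ha, hamin⟩ := Finset.exists_min_image c ZMod.val hcne
    obtain ⟨b, hb, hbmax⟩ := Finset.exists_max_image c ZMod.val hcne
    have hab : a ≠ b := by
      rintro rfl
      have h1 : c ⊆ {a} := fun v hv => Finset.mem_singleton.2
        (hr (le_antisymm (hbmax v hv) (hamin v hv)))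
      have h2 := Finset.card_le_card h1
      rw [hT.1 c hc, Finset.card_singleton] at h2
      omega
    have hsub : (c.filter fun v => (∃ x ∈ c, x.val < v.val) ∧ ∃ y ∈ c, v.val < y.val) ⊆
        (c.erase a).erase b := by
      intro v hv
      obtain ⟨hv, ⟨x, hx, hxv⟩, y, hy, hvy⟩ := Finset.mem_filter.1 hv
      have := hamin x hx
      have := hbmax y hy
      rw [Finset.mem_erase, Finset.mem_erase, ← hr.ne_iff, ← hr.ne_iff]
      exact ⟨by omega, by omega, hv⟩
    refine (Finset.card_le_card hsub).trans ?_
    rw [Finset.card_erase_of_mem (Finset.mem_erase.2 ⟨hab.symm, hb⟩),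
      Finset.card_erase_of_mem ha, hT.1 c hc]
    omega
  have h1 := (Finset.card_le_card hsub).trans (Finset.card_biUnion_le_card_mul _ _ _ hinner)
  have h2 := Finset.le_card_sdiff ({0, e} : Finset (ZMod n)) Finset.univ
  have h3 := Finset.card_le_two (a := (0 : ZMod n)) (b := e)
  omega

theorem val_sub_sub_one (x v : ZMod n) :
    (v - x - 1).val = if x.val < v.val then v.val - x.val - 1 else v.val + n - x.val - 1 := by
  have hx := ZMod.val_lt x
  have hv := ZMod.val_lt v
  have hcast : v - x - 1 = ((v.val + n - x.val - 1 : ℕ) : ZMod n) := by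
    rw [Nat.sub_sub, Nat.cast_sub (by omega)]
    push_cast
    rw [ZMod.natCast_zmod_val, ZMod.natCast_zmod_val, ZMod.natCast_self]
    ring
  rw [hcast, ZMod.val_natCast]
  split_ifs with h
  · rw [show v.val + n - x.val - 1 = (v.val - x.val - 1) + n by omega, Nat.add_mod_right,
      Nat.mod_eq_of_lt (by omega)]
  · rw [Nat.mod_eq_of_lt (by omega)]

theorem mem_arc_univ {v x y : ZMod n} :
    v ∈ arc ZMod.val Finset.univ x y ↔ (v - x - 1).val < pathLen n x y := by
  have hx := ZMod.val_lt x
  have hv := ZMod.val_lt v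
  have hy := ZMod.val_lt y
  rw [mem_arc, pathLen, val_sub_sub_one, val_sub_sub_one]
  simp only [Finset.mem_univ, true_and]
  split_ifs <;> omega

/-- Positions on the way from `i` to `j` correspond to the vertices strictly between them. -/
def arcEquiv (i j : ZMod n) : Fin (pathLen n i j) ≃ {v // v ∈ arc ZMod.val Finset.univ i j} where
  toFun k := ⟨i + 1 + ((k : ℕ) : ZMod n), by
    rw [mem_arc_univ, show i + 1 + ((k : ℕ) : ZMod n) - i - 1 = ((k : ℕ) : ZMod n) by ring,
      ZMod.val_cast_of_lt (k.2.trans (ZMod.val_lt _))]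
    exact k.2⟩
  invFun v := ⟨(v.1 - i - 1).val, mem_arc_univ.1 v.2⟩
  left_inv k := by
    ext
    simp only
    rw [show i + 1 + ((k : ℕ) : ZMod n) - i - 1 = ((k : ℕ) : ZMod n) by ring,
      ZMod.val_cast_of_lt (k.2.trans (ZMod.val_lt _))]
  right_inv v := by
    ext
    simp only
    rw [ZMod.natCast_zmod_val]
    ring

theorem dPathCount_eq_pathCount (d : ℕ) (T : Finset (Finset (ZMod n))) (i j : ZMod n) :
    dPathCount n d T i j = pathCount ZMod.val d Finset.univ T i j := by
  classical
  rw [dPathCount, pathCount, assignmentCount, ← Fintype.card_subtype, ← Nat.card_eq_fintype_card]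
  obtain ⟨S, hS⟩ : ∃ S, S = arc ZMod.val (Finset.univ : Finset (ZMod n)) i j := ⟨_, rfl⟩
  obtain ⟨φ, hφ⟩ : ∃ φ : Fin (pathLen n i j) ≃ {v // v ∈ S},
      ∀ k, (φ k : ZMod n) = i + 1 + ((k : ℕ) : ZMod n) := by
    subst hS
    exact ⟨arcEquiv i j, fun _ => rfl⟩
  rw [← hS]
  have hcard : ∀ (g : ZMod n → Finset (ZMod n)) (c : Finset (ZMod n)),
      (S.filter fun v => g v = c).card =
        (Finset.univ.filter fun k => g (φ k) = c).card := by
    intro g c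
    refine (Finset.card_bij (fun k _ => (φ k : ZMod n)) ?_ ?_ ?_).symm
    · intro k hk
      simpa using hk
    · intro k _ k' _ h
      exact φ.injective (Subtype.ext h)
    · intro v hv
      rw [Finset.mem_filter] at hv
      exact ⟨φ.symm ⟨v, hv.1⟩, by simpa using hv.2, by simp⟩
  refine Nat.card_congr
    { toFun := fun q => ⟨fun v => if h : v ∈ S then (q.1 (φ.symm ⟨v, h⟩) : Finset (ZMod n)) else ∅,
        ?_, ?_, ?_⟩
      invFun := fun g => ⟨fun k => ⟨g.1 (φ k), (g.2.2.1 _ (φ k).2).1⟩, ?_, ?_⟩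
      left_inv := ?_
      right_inv := ?_ }
  · intro v hv
    simp [hv]
  · intro v hv
    simp only [hv, dif_pos, Finset.coe_mem, true_and]
    have := q.2.1 (φ.symm ⟨v, hv⟩)
    rw [← hφ, Equiv.apply_symm_apply] at this
    exact this
  · intro c hc
    rw [hcard]
    have := q.2.2 c hc
    simpa using this
  · intro k
    rw [← hφ]
    exact (g.2.2.1 _ (φ k).2).2
  · intro c hc
    rw [← hcard g.1 c]
    exact g.2.2.2 c hc
  · intro q
    ext k
    simp
  · intro g
    ext v : 2
    by_cases hv : v ∈ S
    · simp [hv]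
    · simp [hv, g.2.1 v hv]

theorem isBoundaryEdge_add_one (hn : 3 ≤ n) (i : ZMod n) :
    IsBoundaryEdge ZMod.val Finset.univ i (i + 1) := by
  have : Fact (1 < n) := ⟨by omega⟩
  refine ⟨Finset.mem_univ _, Finset.mem_univ _, by simp, ?_⟩
  ext v
  rw [mem_arc_univ, pathLen]
  simp

end Polygon

/-- For a `d`-angulation `T` of the convex `n`-gon and distinct boundary edges
`e = (i, i+1)` and `f = (j, j+1)`, the adjacent `2×2` determinant
`d(e,f) = m_{i,j} m_{i+1,j+1} - m_{i,j+1} m_{i+1,j}` is `0` or `1`. -/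
theorem hinge_det_mem (d m n : ℕ) (hd : 3 ≤ d) (hn : n = d + m * (d - 2))
    (T : Finset (Finset (ZMod n))) (hT : IsDAngulation n d T) (i j : ZMod n)
    (hij : i ≠ j) :
    (dPathCount n d T i j : ℤ) * dPathCount n d T (i + 1) (j + 1)
        - dPathCount n d T i (j + 1) * dPathCount n d T (i + 1) j = 0 ∨
    (dPathCount n d T i j : ℤ) * dPathCount n d T (i + 1) (j + 1)
        - dPathCount n d T i (j + 1) * dPathCount n d T (i + 1) j = 1 := by
  have hn3 : 3 ≤ n := by
    rw [hn]
    exact hd.trans (Nat.le_add_right _ _)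
  have : NeZero n := ⟨by omega⟩
  simp only [dPathCount_eq_pathCount]
  exact ((hT.isCombAngulation hd hn3).pathCount_and_det (ZMod.val_injective n) hd).2 i (i + 1) j
    (j + 1) (isBoundaryEdge_add_one hn3 i) (isBoundaryEdge_add_one hn3 j) hij
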